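/- arXiv:0811.3186 — 2 statements merged into one kernel-verified Lean document; each statement's English description precedes it below -/
import Mathlib

section
/- Let n ≥ 1 and let r ≤ −2 be an integer. Let A ∈ tʳ Mₙ(O) ⊂ Mₙ(F) be such that its coefficient A_r of tʳ is a nilpotent matrix. Let g ∈ GLₙ(F) and suppose that B = Ga_{g⁻¹}(A) also lies in tʳ Mₙ(O). Then the coefficient B_r of tʳ in B is nilpotent. -/
open HahnSeries Matrix

noncomputable section

/-- The formal derivative `∂ₜ` on the field `F = ℂ((t))` of formal Laurent series:
`∂ₜ (Σₙ aₙ tⁿ) = Σₙ n aₙ tⁿ⁻¹`. -/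
def dt (f : LaurentSeries ℂ) : LaurentSeries ℂ where
  coeff := fun k => (k + 1 : ℤ) * f.coeff (k + 1)
  isPWO_support' := by
    apply Set.IsPWO.mono (f.isPWO_support'.image_of_monotone
      (f := fun k : ℤ => k - 1) (fun a b h => by simp only []; omega))
    intro k hk
    simp only [Function.mem_support, ne_eq] at hk
    refine ⟨k + 1, ?_, by ring⟩
    simp only [Function.mem_support, ne_eq]
    intro h
    exact hk (by rw [h, mul_zero])

/-- The gaugeGL action of `GLₙ(F)` on `Mₙ(F)`:  `Ga_g(A) = g A g⁻¹ - (∂ₜ g) g⁻¹`. -/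
def gaugeGL {n : ℕ} (g : GL (Fin n) (LaurentSeries ℂ))
    (A : Matrix (Fin n) (Fin n) (LaurentSeries ℂ)) : Matrix (Fin n) (Fin n) (LaurentSeries ℂ) :=
  (g : Matrix (Fin n) (Fin n) (LaurentSeries ℂ)) * A *
      ((g⁻¹ : GL (Fin n) (LaurentSeries ℂ)) : Matrix (Fin n) (Fin n) (LaurentSeries ℂ)) -
    ((g : Matrix (Fin n) (Fin n) (LaurentSeries ℂ)).map dt) *
      ((g⁻¹ : GL (Fin n) (LaurentSeries ℂ)) : Matrix (Fin n) (Fin n) (LaurentSeries ℂ))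

/-- The Euler derivation `t ∂ₜ`. -/
def eulerOp (f : LaurentSeries ℂ) : LaurentSeries ℂ where
  coeff := fun k => (k : ℂ) * f.coeff k
  isPWO_support' := f.isPWO_support'.mono (Function.support_mul_subset_right _ _)

theorem coeff_dt (f : LaurentSeries ℂ) (k : ℤ) :
    (dt f).coeff k = ((k + 1 : ℤ) : ℂ) * f.coeff (k + 1) := rfl

theorem coeff_eulerOp (f : LaurentSeries ℂ) (k : ℤ) :
    (eulerOp f).coeff k = (k : ℂ) * f.coeff k := rfl

theorem support_eulerOp_subset (f : LaurentSeries ℂ) : (eulerOp f).support ⊆ f.support :=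
  Function.support_mul_subset_right _ _

theorem dt_eq_single_mul_eulerOp (f : LaurentSeries ℂ) : dt f = single (-1) 1 * eulerOp f := by
  ext k
  rw [HahnSeries.coeff_single_mul, coeff_dt, coeff_eulerOp]
  simp

theorem eulerOp_mul (f g : LaurentSeries ℂ) :
    eulerOp (f * g) = eulerOp f * g + f * eulerOp g := by
  ext k
  rw [coeff_eulerOp, HahnSeries.coeff_add, HahnSeries.coeff_mul,
    HahnSeries.coeff_mul_left' f.isPWO_support (support_eulerOp_subset f),
    HahnSeries.coeff_mul_right' g.isPWO_support (support_eulerOp_subset g),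
    Finset.mul_sum, ← Finset.sum_add_distrib]
  refine Finset.sum_congr rfl fun ij hij => ?_
  simp only [Finset.mem_antidiagonal] at hij
  rw [coeff_eulerOp, coeff_eulerOp, ← hij.2.2]
  push_cast
  ring

theorem dt_mul (f g : LaurentSeries ℂ) : dt (f * g) = dt f * g + f * dt g := by
  simp only [dt_eq_single_mul_eulerOp, eulerOp_mul]
  ring

theorem dt_add (f g : LaurentSeries ℂ) : dt (f + g) = dt f + dt g := by
  ext k
  simp only [coeff_dt, HahnSeries.coeff_add]
  ring

theorem dt_zero : dt 0 = 0 := by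
  ext k
  simp [coeff_dt]

theorem dt_one : dt 1 = 0 := by
  simpa using dt_mul 1 1

theorem dt_sum {ι : Type*} (s : Finset ι) (f : ι → LaurentSeries ℂ) :
    dt (∑ i ∈ s, f i) = ∑ i ∈ s, dt (f i) :=
  map_sum (⟨⟨dt, dt_zero⟩, dt_add⟩ : LaurentSeries ℂ →+ LaurentSeries ℂ) f s

theorem map_dt_mul {n : ℕ} (X Y : Matrix (Fin n) (Fin n) (LaurentSeries ℂ)) :
    (X * Y).map dt = X.map dt * Y + X * Y.map dt := by
  ext1 i j
  simp only [Matrix.map_apply, Matrix.mul_apply, Matrix.add_apply, dt_sum, dt_mul,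
    Finset.sum_add_distrib]

theorem map_dt_one {n : ℕ} : (1 : Matrix (Fin n) (Fin n) (LaurentSeries ℂ)).map dt = 0 := by
  ext1 i j
  by_cases h : i = j <;> simp [h, dt_one, dt_zero]

/-- The matrix `X` lies in `tᵏ Mₙ(O)`. -/
def OrderGE {n : ℕ} (k : ℤ) (X : Matrix (Fin n) (Fin n) (LaurentSeries ℂ)) : Prop :=
  ∀ i j, ∀ l < k, (X i j).coeff l = 0

/-- The matrix of coefficients of `tᵏ`. -/
def coeffMatrix {n : ℕ} (k : ℤ) (X : Matrix (Fin n) (Fin n) (LaurentSeries ℂ)) :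
    Matrix (Fin n) (Fin n) ℂ :=
  Matrix.of fun i j => (X i j).coeff k

theorem exists_orderGE {n : ℕ} (X : Matrix (Fin n) (Fin n) (LaurentSeries ℂ)) :
    ∃ k, OrderGE k X := by
  obtain ⟨k, hk⟩ := (Set.finite_range fun p : Fin n × Fin n => (X p.1 p.2).order).bddBelow
  exact ⟨k, fun i j l hl => HahnSeries.coeff_eq_zero_of_lt_order
    (hl.trans_le (hk ⟨(i, j), rfl⟩))⟩

theorem coeff_mul_of_lt {f g : LaurentSeries ℂ} {a b l : ℤ} (hf : ∀ k < a, f.coeff k = 0)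
    (hg : ∀ k < b, g.coeff k = 0) (hl : l < a + b) : (f * g).coeff l = 0 := by
  rw [HahnSeries.coeff_mul]
  refine Finset.sum_eq_zero fun ij hij => ?_
  simp only [Finset.mem_antidiagonal] at hij
  rcases lt_or_ge ij.1 a with h | h
  · rw [hf _ h, zero_mul]
  · rw [hg _ (by lia), mul_zero]

theorem coeff_mul_add_of_le {f g : LaurentSeries ℂ} {a b : ℤ} (hf : ∀ k < a, f.coeff k = 0)
    (hg : ∀ k < b, g.coeff k = 0) : (f * g).coeff (a + b) = f.coeff a * g.coeff b := by
  rw [HahnSeries.coeff_mul]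
  refine Finset.sum_eq_single (a, b) (fun ij hij hne => ?_) fun hab => ?_
  · simp only [Finset.mem_antidiagonal] at hij
    rcases lt_or_ge ij.1 a with h | h
    · rw [hf _ h, zero_mul]
    · have h2 : ij.2 < b := by
        by_contra h'
        exact hne (Prod.ext (by lia) (by lia))
      rw [hg _ h2, mul_zero]
  · by_contra h
    exact hab (Finset.mem_antidiagonal.mpr
      ⟨left_ne_zero_of_mul h, right_ne_zero_of_mul h, rfl⟩)

theorem OrderGE.mul {n : ℕ} {X Y : Matrix (Fin n) (Fin n) (LaurentSeries ℂ)} {a b : ℤ}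
    (hX : OrderGE a X) (hY : OrderGE b Y) : OrderGE (a + b) (X * Y) := by
  intro i j l hl
  rw [Matrix.mul_apply, HahnSeries.coeff_sum]
  exact Finset.sum_eq_zero fun k _ => coeff_mul_of_lt (hX i k) (hY k j) hl

theorem OrderGE.succ {n : ℕ} {X : Matrix (Fin n) (Fin n) (LaurentSeries ℂ)} {a : ℤ}
    (hX : OrderGE a X) (h : coeffMatrix a X = 0) : OrderGE (a + 1) X := by
  intro i j l hl
  rcases (Int.lt_add_one_iff.mp hl).lt_or_eq with hl | rfl
  · exact hX i j l hl
  · exact congrFun (congrFun h i) j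

theorem OrderGE.coeffMatrix_eq_zero {n : ℕ} {X : Matrix (Fin n) (Fin n) (LaurentSeries ℂ)}
    {a k : ℤ} (hX : OrderGE a X) (h : k < a) : coeffMatrix k X = 0 := by
  ext i j
  exact hX i j k h

theorem coeffMatrix_mul {n : ℕ} {X Y : Matrix (Fin n) (Fin n) (LaurentSeries ℂ)} {a b : ℤ}
    (hX : OrderGE a X) (hY : OrderGE b Y) :
    coeffMatrix (a + b) (X * Y) = coeffMatrix a X * coeffMatrix b Y := by
  ext i j
  simp only [coeffMatrix, Matrix.of_apply, Matrix.mul_apply, HahnSeries.coeff_sum]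
  exact Finset.sum_congr rfl fun k _ => coeff_mul_add_of_le (hX i k) (hY k j)

/-- The covariant derivative `∂ₜ + A` acting on matrices. -/
def covDeriv {n : ℕ} (A X : Matrix (Fin n) (Fin n) (LaurentSeries ℂ)) :
    Matrix (Fin n) (Fin n) (LaurentSeries ℂ) :=
  X.map dt + A * X

theorem OrderGE.map_dt {n : ℕ} {X : Matrix (Fin n) (Fin n) (LaurentSeries ℂ)} {k : ℤ}
    (hX : OrderGE k X) : OrderGE (k - 1) (X.map dt) := by
  intro i j l hl
  rw [Matrix.map_apply, coeff_dt, hX i j _ (by lia), mul_zero]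

theorem orderGE_covDeriv {n : ℕ} {A X : Matrix (Fin n) (Fin n) (LaurentSeries ℂ)} {r k : ℤ}
    (hr : r ≤ -2) (hA : OrderGE r A) (hX : OrderGE k X) : OrderGE (r + k) (covDeriv A X) := by
  intro i j l hl
  rw [covDeriv, Matrix.add_apply, HahnSeries.coeff_add, (hA.mul hX) i j l hl,
    hX.map_dt i j l (by lia), add_zero]

theorem coeffMatrix_covDeriv {n : ℕ} {A X : Matrix (Fin n) (Fin n) (LaurentSeries ℂ)} {r k : ℤ}
    (hr : r ≤ -2) (hA : OrderGE r A) (hX : OrderGE k X) :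
    coeffMatrix (r + k) (covDeriv A X) = coeffMatrix r A * coeffMatrix k X := by
  rw [← coeffMatrix_mul hA hX]
  ext i j
  simp only [coeffMatrix, Matrix.of_apply, covDeriv, Matrix.add_apply, HahnSeries.coeff_add]
  rw [hX.map_dt i j _ (by lia), zero_add]

theorem orderGE_iterate_covDeriv {n : ℕ} {A X : Matrix (Fin n) (Fin n) (LaurentSeries ℂ)}
    {r k : ℤ} (hr : r ≤ -2) (hA : OrderGE r A) (hX : OrderGE k X) (N : ℕ) :
    OrderGE (N * r + k) ((covDeriv A)^[N] X) := by
  induction N with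
  | zero => simpa using hX
  | succ N ih =>
    rw [Function.iterate_succ_apply']
    convert orderGE_covDeriv hr hA ih using 1
    push_cast
    ring

theorem coeffMatrix_iterate_covDeriv {n : ℕ} {A X : Matrix (Fin n) (Fin n) (LaurentSeries ℂ)}
    {r k : ℤ} (hr : r ≤ -2) (hA : OrderGE r A) (hX : OrderGE k X) (N : ℕ) :
    coeffMatrix (N * r + k) ((covDeriv A)^[N] X) = coeffMatrix r A ^ N * coeffMatrix k X := by
  induction N with
  | zero => simp
  | succ N ih =>
    rw [Function.iterate_succ_apply', pow_succ', Matrix.mul_assoc, ← ih,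
      ← coeffMatrix_covDeriv hr hA (orderGE_iterate_covDeriv hr hA hX N)]
    congr 1
    push_cast
    ring

theorem orderGE_iterate_covDeriv_of_pow_eq_zero {n : ℕ}
    {A X : Matrix (Fin n) (Fin n) (LaurentSeries ℂ)} {r k : ℤ} (hr : r ≤ -2) (hA : OrderGE r A)
    {d : ℕ} (hd : coeffMatrix r A ^ d = 0) (hX : OrderGE k X) (m : ℕ) :
    OrderGE ((d * m : ℕ) * r + k + m) ((covDeriv A)^[d * m] X) := by
  induction m with
  | zero => simpa using hX
  | succ m ih =>
    rw [Nat.mul_succ, Nat.add_comm, Function.iterate_add_apply]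
    convert (orderGE_iterate_covDeriv hr hA ih d).succ
      (by rw [coeffMatrix_iterate_covDeriv hr hA ih, hd, Matrix.zero_mul]) using 1
    push_cast
    ring

theorem mul_covDeriv_gaugeGL_inv {n : ℕ} (g : GL (Fin n) (LaurentSeries ℂ))
    (A X : Matrix (Fin n) (Fin n) (LaurentSeries ℂ)) :
    g.val * covDeriv (gaugeGL g⁻¹ A) X = covDeriv A (g.val * X) := by
  have hinv : g.val * (g⁻¹).val = 1 := g.mul_inv
  have h : g.val.map dt * (g⁻¹).val + g.val * (g⁻¹).val.map dt = 0 := by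
    rw [← map_dt_mul, hinv, map_dt_one]
  have hg : g.val * gaugeGL g⁻¹ A = A * g.val + g.val.map dt := by
    have h' : g.val * (g⁻¹).val.map dt = -(g.val.map dt * (g⁻¹).val) :=
      eq_neg_of_add_eq_zero_right h
    have hinv' : (g⁻¹).val * g.val = 1 := g.inv_mul
    rw [gaugeGL, inv_inv, Matrix.mul_sub, ← Matrix.mul_assoc, ← Matrix.mul_assoc,
      ← Matrix.mul_assoc, hinv, h', Matrix.one_mul, Matrix.neg_mul, Matrix.mul_assoc, hinv',
      Matrix.mul_one, sub_neg_eq_add]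
  rw [covDeriv, covDeriv, map_dt_mul, Matrix.mul_add, ← Matrix.mul_assoc, hg, Matrix.add_mul,
    Matrix.mul_assoc]
  abel

theorem mul_iterate_covDeriv_gaugeGL_inv {n : ℕ} (g : GL (Fin n) (LaurentSeries ℂ))
    (A X : Matrix (Fin n) (Fin n) (LaurentSeries ℂ)) (N : ℕ) :
    g.val * (covDeriv (gaugeGL g⁻¹ A))^[N] X = (covDeriv A)^[N] (g.val * X) :=
  Function.Semiconj.iterate_right (f := fun X => g.val * X)
    (fun X => mul_covDeriv_gaugeGL_inv g A X) N X

theorem orderGE_one {n : ℕ} : OrderGE 0 (1 : Matrix (Fin n) (Fin n) (LaurentSeries ℂ)) := by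
  intro i j l hl
  by_cases h : i = j <;> simp [Matrix.one_apply, h, HahnSeries.coeff_one, hl.ne]

theorem coeffMatrix_one {n : ℕ} :
    coeffMatrix 0 (1 : Matrix (Fin n) (Fin n) (LaurentSeries ℂ)) = 1 := by
  ext i j
  by_cases h : i = j <;> simp [coeffMatrix, Matrix.one_apply, h]

/-- If `A ∈ tʳ Mₙ(O)` (`r ≤ -2`) has nilpotent leading coefficient `A_r`, and the gaugeGL
transform `B = Ga_{g⁻¹}(A)` again lies in `tʳ Mₙ(O)`, then its leading coefficient `B_r`
is nilpotent. -/
theorem leading_coeff_of_gauge_transform_nilpotent (n : ℕ) (hn : 1 ≤ n) (r : ℤ) (hr : r ≤ -2)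
    (A : Matrix (Fin n) (Fin n) (LaurentSeries ℂ))
    (hAO : ∀ i j : Fin n, ∀ k : ℤ, k < r → (A i j).coeff k = 0)
    (hAr : IsNilpotent (Matrix.of fun i j => (A i j).coeff r : Matrix (Fin n) (Fin n) ℂ))
    (g : GL (Fin n) (LaurentSeries ℂ))
    (hBO : ∀ i j : Fin n, ∀ k : ℤ, k < r → ((gaugeGL g⁻¹ A) i j).coeff k = 0) :
    IsNilpotent (Matrix.of fun i j => ((gaugeGL g⁻¹ A) i j).coeff r :
      Matrix (Fin n) (Fin n) ℂ) := by
  obtain ⟨d, hd⟩ := hAr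
  obtain ⟨a, ha⟩ := exists_orderGE g.val
  obtain ⟨b, hb⟩ := exists_orderGE (g⁻¹).val
  obtain ⟨m, hm⟩ : ∃ m : ℕ, 0 < b + a + m := ⟨(1 - (b + a)).toNat, by lia⟩
  have hord := hb.mul (orderGE_iterate_covDeriv_of_pow_eq_zero hr hAO hd ha m)
  have hinv : (g⁻¹).val * g.val = 1 := g.inv_mul
  have hiter := mul_iterate_covDeriv_gaugeGL_inv g A 1 (d * m)
  rw [Matrix.mul_one] at hiter
  rw [← hiter, ← Matrix.mul_assoc, hinv, Matrix.one_mul] at hord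
  have hlead := coeffMatrix_iterate_covDeriv hr hBO orderGE_one (d * m)
  rw [coeffMatrix_one, Matrix.mul_one, hord.coeffMatrix_eq_zero (by lia)] at hlead
  exact ⟨d * m, hlead.symm⟩
end
end

section
/- Let n ≥ 1 and let r ≤ −2 be an integer. Let A ∈ tʳ Mₙ(O) ⊂ Mₙ(F) be such that its coefficient A_r of tʳ is nilpotent (possibly zero). Then there exists g ∈ GLₙ(F) such that B = Ga_g(A) lies in tʳ Mₙ(O) and the coefficient B_r of tʳ in B is a regular nilpotent matrix, i.e., B_rⁿ = 0 and B_rⁿ⁻¹ ≠ 0. (This is the existence of a regular point in the deformed affine Springer fiber Y_A, for G = GLₙ.) -/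
open HahnSeries Matrix

noncomputable section

/-- The Leibniz rule for an additive endomorphism of a commutative ring. -/
def IsLeibniz {R : Type*} [CommRing R] (δ : R →+ R) : Prop :=
  ∀ a b, δ (a * b) = a * δ b + b * δ a

namespace IsLeibniz

open Polynomial

variable {R : Type*} [CommRing R] {δ : R →+ R}

theorem map_one (hδ : IsLeibniz δ) : δ 1 = 0 := by
  simpa using hδ 1 1

theorem map_natCast (hδ : IsLeibniz δ) (a : ℕ) : δ a = 0 := by
  induction a with
  | zero => simp
  | succ a ih => simp [ih, hδ.map_one]

/-- The differential ring structure given by `δ`. -/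
abbrev toDifferential (hδ : IsLeibniz δ) : Differential R :=
  ⟨Derivation.mk' δ.toIntLinearMap hδ⟩

/-- The extension of `δ` to `R[X]` satisfying the Leibniz rule and `X ↦ u`. -/
def extendPoly (hδ : IsLeibniz δ) (u : R) : R[X] →+ R[X] :=
  letI := hδ.toDifferential
  (Differential.implicitDeriv (C u)).toLinearMap.toAddMonoidHom

theorem isLeibniz_extendPoly (hδ : IsLeibniz δ) (u : R) : IsLeibniz (hδ.extendPoly u) :=
  let := hδ.toDifferential
  (Differential.implicitDeriv (C u)).leibniz

theorem extendPoly_C (hδ : IsLeibniz δ) (u a : R) : hδ.extendPoly u (C a) = C (δ a) :=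
  let := hδ.toDifferential
  Differential.implicitDeriv_C _ _

theorem extendPoly_X_pow (hδ : IsLeibniz δ) (u : R) (n : ℕ) :
    hδ.extendPoly u (X ^ n) = C u * ((n : R[X]) * X ^ (n - 1)) := by
  let := hδ.toDifferential
  have h : Differential.implicitDeriv (C u) ((X : R[X]) ^ n) =
      C u * ((n : R[X]) * X ^ (n - 1)) := by
    rw [Derivation.leibniz_pow, Differential.implicitDeriv_X]
    simp only [nsmul_eq_mul, smul_eq_mul]
    ring
  exact h

theorem eval_extendPoly (hδ : IsLeibniz δ) {u x : R} (hx : δ x = u) (p : R[X]) :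
    (hδ.extendPoly u p).eval x = δ (p.eval x) := by
  induction p using Polynomial.induction_on with
  | C a => simp [extendPoly_C]
  | add p q hp hq => simp [hp, hq]
  | monomial n a ih =>
    have hX : hδ.extendPoly u X = C u := by simpa using hδ.extendPoly_X_pow u 1
    rw [pow_succ, ← mul_assoc, hδ.isLeibniz_extendPoly u, hX]
    simp only [eval_add, eval_mul, eval_C, eval_pow, eval_X] at ih ⊢
    rw [ih, hδ (a * x ^ n) x, hx]

end IsLeibniz

section Connection

variable {ι R : Type*} [Fintype ι] [CommRing R]

/-- The connection `v ↦ A v + δ v` on `ι → R`. -/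
def connection (δ : R →+ R) (A : Matrix ι ι R) : (ι → R) →+ (ι → R) where
  toFun v := A *ᵥ v + fun i => δ (v i)
  map_zero' := by ext; simp
  map_add' v w := by ext; simp [Matrix.mulVec_add]; ring

theorem connection_apply (δ : R →+ R) (A : Matrix ι ι R) (v : ι → R) (i : ι) :
    connection δ A v i = (A *ᵥ v) i + δ (v i) := rfl

theorem connection_smul {δ : R →+ R} (hδ : IsLeibniz δ) (A : Matrix ι ι R) (f : R) (v : ι → R) :
    connection δ A (f • v) = f • connection δ A v + δ f • v := by
  ext i
  simp [connection_apply, Matrix.mulVec_smul, hδ _ _]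
  ring

theorem connection_mulVec {δ : R →+ R} (hδ : IsLeibniz δ) {A B H : Matrix ι ι R}
    (h : A * H + H.map δ = H * B) (v : ι → R) :
    connection δ A (H *ᵥ v) = H *ᵥ connection δ B v := by
  ext i
  have h1 : (A *ᵥ H *ᵥ v) i + (H.map δ *ᵥ v) i = (H *ᵥ B *ᵥ v) i := by
    simp only [Matrix.mulVec_mulVec, ← h, Matrix.add_mulVec, Pi.add_apply]
  have h2 : connection δ B v = B *ᵥ v + fun i => δ (v i) := rfl
  rw [connection_apply, h2, Matrix.mulVec_add, Pi.add_apply, ← h1, add_assoc]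
  congr 1
  simp [Matrix.mulVec, dotProduct, hδ _ _, Finset.sum_add_distrib, mul_comm, add_comm]

theorem smul_mul_add_smul_eq [DecidableEq ι] {H H' : Matrix ι ι R} (h : H * H' = 1) (c : R)
    (A X : Matrix ι ι R) :
    (c • A) * H + c • X = H * (c • (H' * (A * H + X))) := by
  rw [Matrix.mul_smul, ← mul_assoc, h, one_mul, Matrix.smul_mul, smul_add]

end Connection

section Cyclic

open Polynomial

variable {ι K : Type*} [Fintype ι] [Field K]

theorem eval_connection {δ : K →+ K} (hδ : IsLeibniz δ) {u x : K} (hx : δ x = u) (A : Matrix ι ι K)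
    (P : ι → K[X]) :
    (fun i => (connection (hδ.extendPoly u) (A.map C) P i).eval x) =
      connection δ A fun i => (P i).eval x := by
  ext i
  simp [connection_apply, hδ.eval_extendPoly hx, Matrix.mulVec, dotProduct, eval_finsetSum]

theorem eval_connection_iterate {δ : K →+ K} (hδ : IsLeibniz δ) {u x : K} (hx : δ x = u)
    (A : Matrix ι ι K) (k : ℕ) (P : ι → K[X]) :
    (fun i => ((connection (hδ.extendPoly u) (A.map C))^[k] P i).eval x) =
      (connection δ A)^[k] fun i => (P i).eval x := by
  induction k with
  | zero => rfl
  | succ k ih => simp only [Function.iterate_succ_apply', eval_connection hδ hx, ih]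

theorem connection_iterate_X_pow_smul {δ : K →+ K} (hδ : IsLeibniz δ) (u : K) (A : Matrix ι ι K[X])
    (w : ι → K[X]) (m i : ℕ) (hi : i ≤ m) :
    ∃ Q, (connection (hδ.extendPoly u) A)^[i] ((X : K[X]) ^ m • w) =
      (X : K[X]) ^ (m - i) • (C (m.descFactorial i * u ^ i) • w + (X : K[X]) • Q) := by
  induction i with
  | zero => exact ⟨0, by simp⟩
  | succ i ih =>
    obtain ⟨Q, hQ⟩ := ih (by omega)
    obtain ⟨j, rfl⟩ : ∃ j, m = i + 1 + j := ⟨m - (i + 1), by omega⟩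
    have e1 : i + 1 + j - i = j + 1 := by omega
    have e2 : i + 1 + j - (i + 1) = j := by omega
    refine ⟨connection (hδ.extendPoly u) A
      (C ((i + 1 + j).descFactorial i * u ^ i : K) • w + (X : K[X]) • Q) + C ((j + 1) * u) • Q, ?_⟩
    rw [Function.iterate_succ_apply', hQ, connection_smul (hδ.isLeibniz_extendPoly u), e1, e2,
      Nat.descFactorial_succ, e1]
    ext1 k
    simp [hδ.extendPoly_X_pow]
    ring

theorem exists_connection_iterate_eval_zero [CharZero K] {δ : K →+ K} (hδ : IsLeibniz δ) {u : K}
    (hu : u ≠ 0) (A : Matrix ι ι K[X]) (b : ℕ → ι → K) (m : ℕ) :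
    ∃ P : ι → K[X], ∀ i < m,
      (fun j => ((connection (hδ.extendPoly u) A)^[i] P j).eval 0) = b i := by
  induction m with
  | zero => exact ⟨0, by simp⟩
  | succ m ih =>
    obtain ⟨P, hP⟩ := ih
    let w : ι → K[X] := fun j => C ((m.factorial * u ^ m)⁻¹ *
      (b m j - ((connection (hδ.extendPoly u) A)^[m] P j).eval 0))
    refine ⟨P + (X : K[X]) ^ m • w, fun i hi => ?_⟩
    obtain ⟨Q, hQ⟩ := connection_iterate_X_pow_smul hδ u A w m i (by omega)
    have hne : (m.factorial * u ^ m : K) ≠ 0 :=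
      mul_ne_zero (by exact_mod_cast m.factorial_ne_zero) (pow_ne_zero _ hu)
    rw [iterate_map_add, hQ]
    rcases Nat.lt_succ_iff_lt_or_eq.1 hi with hlt | rfl
    · rw [← hP i hlt]
      ext j
      simp [show m - i ≠ 0 by omega]
    · ext j
      simp only [w, Pi.add_apply, Pi.smul_apply, smul_eq_mul, eval_add, eval_mul, eval_X,
        eval_C, one_mul, zero_mul, add_zero, Nat.sub_self, pow_zero, Nat.descFactorial_self]
      rw [mul_inv_cancel_left₀ hne]
      ring

/-- The cyclic vector theorem. -/
theorem exists_cyclic_vector [CharZero K] {n : ℕ} {δ : K →+ K} (hδ : IsLeibniz δ) {t : K}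
    (ht : δ t ≠ 0) (A : Matrix (Fin n) (Fin n) K) :
    ∃ e : Fin n → K, (Matrix.of fun (i j : Fin n) => (connection δ A)^[i] e j).det ≠ 0 := by
  obtain ⟨P, hP⟩ := exists_connection_iterate_eval_zero hδ ht (A.map C)
    (fun k j => if k = j then 1 else 0) n
  set q : K[X] := Matrix.det (Matrix.of fun (i j : Fin n) =>
    (connection (hδ.extendPoly (δ t)) (A.map C))^[i] P j) with hq
  have heval (x : K) : q.eval x = (Matrix.of fun (i j : Fin n) =>
      ((connection (hδ.extendPoly (δ t)) (A.map C))^[i] P j).eval x).det := by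
    rw [hq, ← coe_evalRingHom, RingHom.map_det]
    rfl
  have hq0 : q ≠ 0 := by
    intro h0
    have h1 : q.eval 0 = 1 := by
      rw [heval, ← Matrix.det_one (n := Fin n)]
      congr 1
      ext i j
      simpa [Matrix.one_apply, Fin.ext_iff] using congrFun (hP i i.2) j
    simp [h0] at h1
  obtain ⟨a, ha⟩ : ∃ a : ℕ, q.eval (t - a) ≠ 0 := by
    by_contra! h
    refine hq0 (q.eq_zero_of_infinite_isRoot (Set.infinite_of_injective_forall_mem
      (f := fun a : ℕ => t - a) (fun a b hab => ?_) h))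
    simpa using hab
  refine ⟨fun j => (P j).eval (t - a), ?_⟩
  rw [heval] at ha
  convert ha using 2
  ext i j
  exact (congrFun (eval_connection_iterate hδ (by simp [hδ.map_natCast]) A i P) j).symm

end Cyclic

section Laurent

local notation "F" => LaurentSeries ℂ

theorem coeff_single_one_mul_dt (f : F) (k : ℤ) :
    (single (1 : ℤ) (1 : ℂ) * dt f).coeff k = k * f.coeff k := by
  rw [coeff_single_mul]
  simp [dt]

/-- The operator `tˢ ∂ₜ`. -/
def powDerivation (s : ℤ) : F →+ F :=
  AddMonoidHom.mk' (fun f => single s (1 : ℂ) * dt f) (fun f g => by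
    ext k
    simp only [coeff_add, coeff_single_mul, dt]
    ring)

theorem powDerivation_apply (s : ℤ) (f : F) :
    powDerivation s f = single s (1 : ℂ) * dt f := rfl

theorem powDerivation_eq (s : ℤ) (f : F) :
    powDerivation s f = single (s - 1) (1 : ℂ) * powDerivation 1 f := by
  simp [powDerivation_apply, ← mul_assoc]

theorem isLeibniz_powDerivation_one : IsLeibniz (powDerivation 1) := fun f g => by
  have hs (f : F) : (powDerivation 1 f).support ⊆ f.support := by
    intro k hk hf
    exact hk (by simp [powDerivation_apply, coeff_single_one_mul_dt, hf])
  ext k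
  rw [mul_comm g, coeff_add, coeff_mul_right' g.isPWO_support (hs g),
    coeff_mul_left' f.isPWO_support (hs f), powDerivation_apply, coeff_single_one_mul_dt, coeff_mul,
    Finset.mul_sum, ← Finset.sum_add_distrib]
  refine Finset.sum_congr rfl fun ij hij => ?_
  rw [powDerivation_apply, powDerivation_apply, coeff_single_one_mul_dt, coeff_single_one_mul_dt,
    ← (Finset.mem_antidiagonal.1 hij).2.2]
  push_cast
  ring

theorem isLeibniz_powDerivation (s : ℤ) : IsLeibniz (powDerivation s) := fun f g => by
  rw [powDerivation_eq, isLeibniz_powDerivation_one, powDerivation_eq s f, powDerivation_eq s g]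
  ring

theorem coeff_powDerivation (s : ℤ) (f : F) (k : ℤ) :
    (powDerivation s f).coeff k = ((k - s + 1 : ℤ) : ℂ) * f.coeff (k - s + 1) := by
  rw [powDerivation_apply, coeff_single_mul]
  simp [dt]

theorem coeff_mul_eq_zero_of_lt {f g : F} {a b k : ℤ} (hf : ∀ i < a, f.coeff i = 0)
    (hg : ∀ i < b, g.coeff i = 0) (hk : k < a + b) : (f * g).coeff k = 0 := by
  rw [coeff_mul]
  refine Finset.sum_eq_zero fun ij hij => ?_
  have h := (Finset.mem_antidiagonal.1 hij).2.2
  rcases lt_or_ge ij.1 a with h1 | h1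
  · rw [hf _ h1, zero_mul]
  · rw [hg _ (by omega), mul_zero]

theorem coeff_mul_add_of_lt {f g : F} {a b : ℤ} (hf : ∀ i < a, f.coeff i = 0)
    (hg : ∀ i < b, g.coeff i = 0) : (f * g).coeff (a + b) = f.coeff a * g.coeff b := by
  rw [coeff_mul]
  refine Finset.sum_eq_single (a, b) (fun ij hij hne => ?_) (fun h => ?_)
  · have h := (Finset.mem_antidiagonal.1 hij).2.2
    rcases lt_trichotomy ij.1 a with h1 | h1 | h1
    · rw [hf _ h1, zero_mul]
    · exact absurd (Prod.ext h1 (by simp; omega)) hne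
    · rw [hg _ (by omega), mul_zero]
  · rw [Finset.mem_antidiagonal] at h
    simp only [mem_support, and_true, not_and_or, not_not] at h
    rcases h with h | h <;> simp [h]

variable {n : ℕ}

/-- The vector `v` lies in `tᵐ Oⁿ`. -/
def VanishesBelow (m : ℤ) (v : Fin n → F) : Prop := ∀ i, ∀ k < m, (v i).coeff k = 0

/-- The coefficient of `tᵐ`. -/
def vecCoeff (m : ℤ) (v : Fin n → F) : Fin n → ℂ := fun i => (v i).coeff m

/-- The matrix of coefficients of `tᵐ`. -/
def matCoeff (m : ℤ) (A : Matrix (Fin n) (Fin n) F) : Matrix (Fin n) (Fin n) ℂ :=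
  Matrix.of fun i j => (A i j).coeff m

theorem VanishesBelow.succ {m : ℤ} {v : Fin n → F} (h : VanishesBelow m v)
    (h' : vecCoeff m v = 0) : VanishesBelow (m + 1) v := fun i k hk => by
  rcases (Int.lt_add_one_iff.1 hk).lt_or_eq with h1 | rfl
  · exact h i k h1
  · exact congrFun h' i

theorem exists_vanishesBelow (v : Fin n → F) : ∃ m, VanishesBelow m v := by
  cases n with
  | zero => exact ⟨0, fun i => i.elim0⟩
  | succ n =>
    refine ⟨Finset.univ.inf' Finset.univ_nonempty fun i => (v i).order, fun i k hk => ?_⟩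
    exact coeff_eq_zero_of_lt_order (hk.trans_le (Finset.inf'_le _ (Finset.mem_univ i)))

theorem VanishesBelow.mulVec {a m : ℤ} {A : Matrix (Fin n) (Fin n) F}
    (hA : ∀ i j, ∀ k < a, (A i j).coeff k = 0) {v : Fin n → F} (hv : VanishesBelow m v) :
    VanishesBelow (a + m) (A *ᵥ v) := fun i k hk => by
  simp only [Matrix.mulVec, dotProduct, coeff_sum]
  exact Finset.sum_eq_zero fun j _ => coeff_mul_eq_zero_of_lt (hA i j) (hv j) hk

theorem vecCoeff_mulVec {a m : ℤ} {A : Matrix (Fin n) (Fin n) F}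
    (hA : ∀ i j, ∀ k < a, (A i j).coeff k = 0) {v : Fin n → F} (hv : VanishesBelow m v) :
    vecCoeff (a + m) (A *ᵥ v) = matCoeff a A *ᵥ vecCoeff m v := by
  ext i
  simp only [vecCoeff, matCoeff, Matrix.mulVec, dotProduct, coeff_sum, Matrix.of_apply]
  exact Finset.sum_congr rfl fun j _ => coeff_mul_add_of_lt (hA i j) (hv j)

theorem exists_matrix_bound (A : Matrix (Fin n) (Fin n) F) :
    ∃ a : ℤ, ∀ i j, ∀ k < a, (A i j).coeff k = 0 := by
  choose m hm using fun i => exists_vanishesBelow (A i)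
  cases n with
  | zero => exact ⟨0, fun i => i.elim0⟩
  | succ n =>
    exact ⟨Finset.univ.inf' Finset.univ_nonempty m, fun i j k hk =>
      hm i j k (hk.trans_le (Finset.inf'_le _ (Finset.mem_univ i)))⟩

section

variable {s : ℤ} {A : Matrix (Fin n) (Fin n) F} {m : ℤ} {v : Fin n → F}

theorem VanishesBelow.connection (hs : 2 ≤ s) (hA : ∀ i j, ∀ k < 0, (A i j).coeff k = 0)
    (hv : VanishesBelow m v) :
    VanishesBelow m (connection (powDerivation s) A v) := fun i k hk => by
  rw [connection_apply, coeff_add, coeff_powDerivation, hv i _ (by omega), mul_zero, add_zero]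
  exact hv.mulVec hA i k (by omega)

theorem vecCoeff_connection (hs : 2 ≤ s) (hA : ∀ i j, ∀ k < 0, (A i j).coeff k = 0)
    (hv : VanishesBelow m v) :
    vecCoeff m (_root_.connection (powDerivation s) A v) = matCoeff 0 A *ᵥ vecCoeff m v := by
  rw [← vecCoeff_mulVec hA hv, zero_add]
  ext i
  simp [vecCoeff, connection_apply, coeff_powDerivation, hv i (m - s + 1) (by omega)]

theorem VanishesBelow.connection_iterate (hs : 2 ≤ s)
    (hA : ∀ i j, ∀ k < 0, (A i j).coeff k = 0) (hv : VanishesBelow m v) (N : ℕ) :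
    VanishesBelow m ((_root_.connection (powDerivation s) A)^[N] v) ∧
    vecCoeff m ((_root_.connection (powDerivation s) A)^[N] v) =
      (matCoeff 0 A) ^ N *ᵥ vecCoeff m v := by
  induction N with
  | zero => simpa using hv
  | succ N ih =>
    rw [Function.iterate_succ_apply']
    refine ⟨ih.1.connection hs hA, ?_⟩
    rw [vecCoeff_connection hs hA ih.1, ih.2, Matrix.mulVec_mulVec, pow_succ']

theorem VanishesBelow.connection_iterate_mul (hs : 2 ≤ s)
    (hA : ∀ i j, ∀ k < 0, (A i j).coeff k = 0) {p : ℕ} (hp : matCoeff 0 A ^ p = 0)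
    (hv : VanishesBelow m v) (j : ℕ) :
    VanishesBelow (m + j) ((_root_.connection (powDerivation s) A)^[p * j] v) := by
  induction j with
  | zero => simpa using hv
  | succ j ih =>
    rw [Nat.mul_succ, add_comm (p * j) p, Function.iterate_add_apply, Nat.cast_succ, ← add_assoc]
    obtain ⟨h1, h2⟩ := ih.connection_iterate hs hA p
    exact h1.succ (by rw [h2, hp, Matrix.zero_mulVec])

end

theorem exists_powerSeries_of_coeff {f : F} (hf : ∀ k < 0, f.coeff k = 0) :
    ∃ p : PowerSeries ℂ, algebraMap (PowerSeries ℂ) F p = f := by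
  refine ⟨PowerSeries.mk fun k => f.coeff k, ?_⟩
  ext k
  rw [LaurentSeries.coe_algebraMap, PowerSeries.coeff_coe]
  split_ifs with h
  · exact (hf k h).symm
  · rw [PowerSeries.coeff_mk, Int.natAbs_of_nonneg (not_lt.1 h)]

theorem coeff_algebraMap_of_neg (p : PowerSeries ℂ) {k : ℤ} (hk : k < 0) :
    (algebraMap (PowerSeries ℂ) F p).coeff k = 0 := by
  rw [LaurentSeries.coe_algebraMap, PowerSeries.coeff_coe, if_pos hk]

/-- A submodule of a bounded one is finitely generated. -/
theorem fg_of_vanishesBelow {m : ℤ} {M : Submodule (PowerSeries ℂ) (Fin n → F)}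
    (hM : ∀ v ∈ M, VanishesBelow m v) : M.FG := by
  let φ : (Fin n → PowerSeries ℂ) →ₗ[PowerSeries ℂ] (Fin n → F) :=
    LinearMap.pi fun i => (LinearMap.mulLeft (PowerSeries ℂ) (single m (1 : ℂ))).comp
      ((Algebra.linearMap (PowerSeries ℂ) F).comp (LinearMap.proj i))
  have hle : M ≤ LinearMap.range φ := by
    intro v hv
    have h (i : Fin n) : ∃ p : PowerSeries ℂ,
        algebraMap (PowerSeries ℂ) F p = single (-m) (1 : ℂ) * v i :=
      exists_powerSeries_of_coeff fun k hk => by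
        rw [coeff_single_mul, one_mul]
        exact hM v hv i _ (by omega)
    choose p hp using h
    refine ⟨p, ?_⟩
    ext1 i
    simp [φ, hp, ← mul_assoc]
  have := isNoetherian_of_le hle
  rw [← Module.Finite.iff_fg]
  infer_instance

theorem algebraMap_smul_vec (p : PowerSeries ℂ) (v : Fin n → F) :
    algebraMap (PowerSeries ℂ) F p • v = p • v :=
  algebraMap_smul F p v

/-- An `O`-lattice in `Fⁿ` is the image of the standard one under some `h ∈ GLₙ(F)`. -/
theorem exists_GL_mulVec_mem_iff (M : Submodule (PowerSeries ℂ) (Fin n → F))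
    [Submodule.IsLattice F M] :
    ∃ h : GL (Fin n) F, ∀ w, (h : Matrix (Fin n) (Fin n) F) *ᵥ w ∈ M ↔ VanishesBelow 0 w := by
  have hc : Module.finrank (PowerSeries ℂ) M = n := by
    simpa using Submodule.IsLattice.finrank_of_pi F M
  let b := Module.finBasisOfFinrankEq (PowerSeries ℂ) M hc
  let B := b.extendOfIsLattice F
  have hB (w : Fin n → F) : (Pi.basisFun F (Fin n)).toMatrix B *ᵥ w = ∑ i, w i • B i := by
    ext j
    simp [Matrix.mulVec, dotProduct, Module.Basis.toMatrix_apply, mul_comm]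
  refine ⟨⟨(Pi.basisFun F (Fin n)).toMatrix B, B.toMatrix (Pi.basisFun F (Fin n)),
    Module.Basis.toMatrix_mul_toMatrix_flip _ _, Module.Basis.toMatrix_mul_toMatrix_flip _ _⟩,
    fun w => ?_⟩
  change (Pi.basisFun F (Fin n)).toMatrix B *ᵥ w ∈ M ↔ _
  rw [hB]
  constructor
  · intro h i k hk
    have h1 : ∑ i, w i • B i = ∑ i, algebraMap (PowerSeries ℂ) F (b.repr ⟨_, h⟩ i) • B i := by
      have h3 := congrArg Subtype.val (b.sum_repr ⟨_, h⟩)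
      simp only [Submodule.coe_sum, Submodule.coe_smul] at h3
      simp only [algebraMap_smul_vec, B, Module.Basis.extendOfIsLattice_apply] at h3 ⊢
      exact h3.symm
    have h2 : w i = algebraMap (PowerSeries ℂ) F (b.repr ⟨_, h⟩ i) := by
      have := congrArg (fun x => B.repr x i) h1
      rwa [B.repr_sum_self, B.repr_sum_self] at this
    rw [h2, coeff_algebraMap_of_neg _ hk]
  · intro h
    choose p hp using fun i => exists_powerSeries_of_coeff (h i)
    refine M.sum_mem fun i _ => ?_
    rw [← hp i, algebraMap_smul_vec, Module.Basis.extendOfIsLattice_apply]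
    exact M.smul_mem _ (b i).2

theorem powDerivation_single_one_ne_zero (s : ℤ) : powDerivation s (single 1 1) ≠ 0 := by
  intro h
  have := congrArg (fun f : F => f.coeff s) h
  simp [coeff_powDerivation] at this

theorem map_mul_of_isLeibniz {ι R : Type*} [Fintype ι] [CommRing R] {δ : R →+ R}
    (hδ : IsLeibniz δ) (X Y : Matrix ι ι R) :
    (X * Y).map δ = X * Y.map δ + X.map δ * Y := by
  ext i j
  simp only [Matrix.map_apply, Matrix.mul_apply, Matrix.add_apply, map_sum,
    ← Finset.sum_add_distrib]
  exact Finset.sum_congr rfl fun k _ => by rw [hδ]; ring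

theorem gaugeGL_inv (h : GL (Fin n) F) (A : Matrix (Fin n) (Fin n) F) :
    gaugeGL h⁻¹ A =
      (↑h⁻¹ : Matrix (Fin n) (Fin n) F) * (A * (h : Matrix (Fin n) (Fin n) F) + h.1.map dt) := by
  have hdt : (powDerivation 0 : F → F) = dt := by
    ext1 f
    simp [powDerivation_apply]
  have h1 := map_mul_of_isLeibniz (isLeibniz_powDerivation 0) (↑h⁻¹ : Matrix (Fin n) (Fin n) F)
    (h : Matrix (Fin n) (Fin n) F)
  have h2 : (1 : Matrix (Fin n) (Fin n) F).map (powDerivation 0) = 0 := by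
    ext1 i j
    rw [Matrix.map_apply, Matrix.one_apply]
    split_ifs
    · exact (isLeibniz_powDerivation 0).map_one
    · exact map_zero _
  rw [Units.inv_mul, h2, hdt] at h1
  rw [gaugeGL, inv_inv, mul_add, ← mul_assoc, sub_eq_add_neg, eq_neg_of_add_eq_zero_right h1.symm,
    neg_neg]

theorem pow_card_eq_zero_of_isNilpotent {N : Matrix (Fin n) (Fin n) ℂ} (hN : IsNilpotent N) :
    N ^ n = 0 := by
  have h := (Matrix.isNilpotent_charpoly_sub_pow_of_isNilpotent hN).eq_zero
  have h2 := N.aeval_self_charpoly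
  rw [sub_eq_zero.1 h] at h2
  simpa using h2

theorem pow_pred_ne_zero_of_span_eq_top (hn : 1 ≤ n) {N : Matrix (Fin n) (Fin n) ℂ}
    {c : Fin n → ℂ} (hc : Submodule.span ℂ (Set.range fun k : ℕ => (N ^ k) *ᵥ c) = ⊤) :
    N ^ (n - 1) ≠ 0 := by
  intro h0
  let b : Fin (n - 1) → Fin n → ℂ := fun k => (N ^ (k : ℕ)) *ᵥ c
  have hle : Submodule.span ℂ (Set.range fun k : ℕ => (N ^ k) *ᵥ c) ≤
      Submodule.span ℂ (Set.range b) := by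
    rw [Submodule.span_le]
    rintro _ ⟨k, rfl⟩
    by_cases hk : k < n - 1
    · exact Submodule.subset_span ⟨⟨k, hk⟩, rfl⟩
    · simp [pow_eq_zero_of_le (not_lt.1 hk) h0]
  have h1 := finrank_range_le_card (R := ℂ) b
  rw [hc, top_le_iff] at hle
  rw [Set.finrank, hle, finrank_top, Module.finrank_fin_fun,
    Fintype.card_fin] at h1
  omega

section

variable {s : ℤ} {A : Matrix (Fin n) (Fin n) F}

/-- The `O`-module generated by the iterates of a vector under `tˢ ∂ₜ + A`. -/
def orbitSpan (s : ℤ) (A : Matrix (Fin n) (Fin n) F) (e : Fin n → F) :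
    Submodule (PowerSeries ℂ) (Fin n → F) :=
  Submodule.span _ (Set.range fun k : ℕ => (connection (powDerivation s) A)^[k] e)

theorem iterate_mem_orbitSpan (e : Fin n → F) (k : ℕ) :
    (connection (powDerivation s) A)^[k] e ∈ orbitSpan s A e :=
  Submodule.subset_span ⟨k, rfl⟩

theorem connection_mem_orbitSpan (hs : 2 ≤ s) {e v : Fin n → F} (hv : v ∈ orbitSpan s A e) :
    connection (powDerivation s) A v ∈ orbitSpan s A e := by
  induction hv using Submodule.span_induction with
  | mem v hv =>
    obtain ⟨k, rfl⟩ := hv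
    simpa only [Function.iterate_succ_apply'] using iterate_mem_orbitSpan e (k + 1)
  | zero => simp
  | add v w _ _ hv hw => simpa using add_mem hv hw
  | smul p v hv' hv =>
    obtain ⟨q, hq⟩ : ∃ q : PowerSeries ℂ, algebraMap (PowerSeries ℂ) F q =
        powDerivation s (algebraMap (PowerSeries ℂ) F p) :=
      exists_powerSeries_of_coeff fun k hk => by
        rw [coeff_powDerivation, coeff_algebraMap_of_neg _ (by omega), mul_zero]
    rw [← algebraMap_smul_vec, connection_smul (isLeibniz_powDerivation s), ← hq,
      algebraMap_smul_vec, algebraMap_smul_vec]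
    exact add_mem (Submodule.smul_mem _ _ hv) (Submodule.smul_mem _ _ hv')

theorem vanishesBelow_of_mem_orbitSpan (hs : 2 ≤ s) (hA : ∀ i j, ∀ k < 0, (A i j).coeff k = 0)
    {m : ℤ} {e v : Fin n → F} (he : VanishesBelow m e) (hv : v ∈ orbitSpan s A e) :
    VanishesBelow m v := by
  induction hv using Submodule.span_induction with
  | mem v hv =>
    obtain ⟨k, rfl⟩ := hv
    exact (he.connection_iterate hs hA k).1
  | zero => exact fun i k _ => rfl
  | add v w _ _ hv hw =>
    intro i k hk
    rw [Pi.add_apply, coeff_add, hv i k hk, hw i k hk, add_zero]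
  | smul p v _ hv =>
    intro i k hk
    rw [← algebraMap_smul_vec]
    exact coeff_mul_eq_zero_of_lt (fun _ h => coeff_algebraMap_of_neg p h) (hv i) (by omega)

theorem isLattice_orbitSpan (hs : 2 ≤ s) (hA : ∀ i j, ∀ k < 0, (A i j).coeff k = 0)
    {e : Fin n → F} (he : (Matrix.of fun (i j : Fin n) =>
      (connection (powDerivation s) A)^[i] e j).det ≠ 0) :
    Submodule.IsLattice F (orbitSpan s A e) where
  fg := by
    obtain ⟨m, hm⟩ := exists_vanishesBelow e
    exact fg_of_vanishesBelow fun v hv => vanishesBelow_of_mem_orbitSpan hs hA hm hv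
  span_eq_top := by
    have hli := Matrix.linearIndependent_rows_iff_isUnit.2
      ((Matrix.isUnit_iff_isUnit_det _).2 he.isUnit)
    rw [eq_top_iff, ← hli.span_eq_top_of_card_eq_finrank' (by simp)]
    refine Submodule.span_mono ?_
    rintro _ ⟨i, rfl⟩
    exact iterate_mem_orbitSpan e i

variable {B : Matrix (Fin n) (Fin n) F} {h : GL (Fin n) F}

theorem inv_mulVec_mulVec (h : GL (Fin n) F) (v : Fin n → F) :
    (↑h⁻¹ : Matrix (Fin n) (Fin n) F) *ᵥ ((h : Matrix (Fin n) (Fin n) F) *ᵥ v) = v := by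
  rw [Matrix.mulVec_mulVec, Units.inv_mul, Matrix.one_mulVec]

theorem mulVec_inv_mulVec (h : GL (Fin n) F) (v : Fin n → F) :
    (h : Matrix (Fin n) (Fin n) F) *ᵥ ((↑h⁻¹ : Matrix (Fin n) (Fin n) F) *ᵥ v) = v := by
  rw [Matrix.mulVec_mulVec, Units.mul_inv, Matrix.one_mulVec]

theorem connection_iterate_mulVec
    (hB : A * h.1 + h.1.map (powDerivation s) = h.1 * B) (k : ℕ) (w : Fin n → F) :
    (connection (powDerivation s) A)^[k] (h.1 *ᵥ w) =
      h.1 *ᵥ (connection (powDerivation s) B)^[k] w :=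
  (Function.Semiconj.iterate_right
    (fun w => (connection_mulVec (isLeibniz_powDerivation s) hB w).symm) k w).symm

theorem vanishesBelow_single_zero (c : Fin n → ℂ) :
    VanishesBelow 0 (fun i => (single (0 : ℤ) (c i) : F)) := fun _ _ hk =>
  coeff_single_of_ne hk.ne

theorem vecCoeff_single_zero (c : Fin n → ℂ) :
    vecCoeff 0 (fun i => (single (0 : ℤ) (c i) : F)) = c :=
  funext fun _ => coeff_single_same _ _

theorem isNilpotent_matCoeff_of_gauge (hs : 2 ≤ s) (hA : ∀ i j, ∀ k < 0, (A i j).coeff k = 0)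
    (hAn : IsNilpotent (matCoeff 0 A)) (hB0 : ∀ i j, ∀ k < 0, (B i j).coeff k = 0)
    (hB : A * h.1 + h.1.map (powDerivation s) = h.1 * B) : IsNilpotent (matCoeff 0 B) := by
  obtain ⟨p, hp⟩ := hAn
  obtain ⟨a, ha⟩ := exists_matrix_bound h.1
  obtain ⟨a', ha'⟩ := exists_matrix_bound (↑h⁻¹ : Matrix (Fin n) (Fin n) F)
  let j : ℕ := (1 - a - a').toNat
  refine ⟨p * j, Matrix.ext_iff_mulVec.2 fun c => ?_⟩
  have h1 := ((vanishesBelow_single_zero c).mulVec ha).connection_iterate_mul hs hA hp j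
  rw [connection_iterate_mulVec hB] at h1
  have h2 := h1.mulVec ha'
  rw [inv_mulVec_mulVec] at h2
  have h3 := ((vanishesBelow_single_zero c).connection_iterate hs hB0 (p * j)).2
  rw [vecCoeff_single_zero] at h3
  rw [← h3, Matrix.zero_mulVec]
  ext i
  exact h2 i 0 (by omega)

theorem span_matCoeff_pow_mulVec_eq_top (hs : 2 ≤ s)
    (hB0 : ∀ i j, ∀ k < 0, (B i j).coeff k = 0)
    (hB : A * h.1 + h.1.map (powDerivation s) = h.1 * B) {e : Fin n → F}
    (hM : ∀ w, h.1 *ᵥ w ∈ orbitSpan s A e ↔ VanishesBelow 0 w) :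
    Submodule.span ℂ (Set.range fun k : ℕ =>
      (matCoeff 0 B ^ k) *ᵥ vecCoeff 0 ((↑h⁻¹ : Matrix (Fin n) (Fin n) F) *ᵥ e)) = ⊤ := by
  set S := Submodule.span ℂ (Set.range fun k : ℕ =>
      (matCoeff 0 B ^ k) *ᵥ vecCoeff 0 ((↑h⁻¹ : Matrix (Fin n) (Fin n) F) *ᵥ e))
  have hinv {v : Fin n → F} (hv : v ∈ orbitSpan s A e) :
      VanishesBelow 0 ((↑h⁻¹ : Matrix (Fin n) (Fin n) F) *ᵥ v) := by
    rwa [← hM, mulVec_inv_mulVec]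
  have key (v : Fin n → F) (hv : v ∈ orbitSpan s A e) :
      vecCoeff 0 ((↑h⁻¹ : Matrix (Fin n) (Fin n) F) *ᵥ v) ∈ S := by
    induction hv using Submodule.span_induction with
    | mem v hv =>
      obtain ⟨k, rfl⟩ := hv
      have he : VanishesBelow 0 ((↑h⁻¹ : Matrix (Fin n) (Fin n) F) *ᵥ e) :=
        hinv (iterate_mem_orbitSpan e 0)
      have h1 := connection_iterate_mulVec hB k ((↑h⁻¹ : Matrix (Fin n) (Fin n) F) *ᵥ e)
      rw [mulVec_inv_mulVec] at h1
      simp only [h1, inv_mulVec_mulVec]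
      rw [(VanishesBelow.connection_iterate hs hB0 he k).2]
      exact Submodule.subset_span ⟨k, rfl⟩
    | zero =>
      rw [Matrix.mulVec_zero]
      exact S.zero_mem
    | add v w _ _ hv hw =>
      rw [Matrix.mulVec_add]
      exact S.add_mem hv hw
    | smul p v hv' hv =>
      have h1 : vecCoeff 0 ((↑h⁻¹ : Matrix (Fin n) (Fin n) F) *ᵥ (p • v)) =
          (algebraMap (PowerSeries ℂ) F p).coeff 0 •
            vecCoeff 0 ((↑h⁻¹ : Matrix (Fin n) (Fin n) F) *ᵥ v) := by
        rw [← algebraMap_smul_vec, Matrix.mulVec_smul]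
        ext i
        exact coeff_mul_add_of_lt (a := 0) (b := 0) (fun _ h => coeff_algebraMap_of_neg p h)
          (hinv hv' i)
      rw [h1]
      exact S.smul_mem _ hv
  refine eq_top_iff.2 fun c _ => ?_
  have h2 := key _ ((hM _).2 (vanishesBelow_single_zero c))
  rwa [inv_mulVec_mulVec, vecCoeff_single_zero] at h2

end

end Laurent


/-- Existence of a regular point in the deformed affine Springer fiber for `GLₙ`: if
`A ∈ tʳ Mₙ(O)` (`r ≤ -2`) has nilpotent (possibly zero) leading coefficient, then there is
`g ∈ GLₙ(F)` such that `B = Ga_g(A) ∈ tʳ Mₙ(O)` and `B_r` is regular nilpotent. -/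
theorem exists_gauge_with_regular_nilpotent_leading_term (n : ℕ) (hn : 1 ≤ n)
    (r : ℤ) (hr : r ≤ -2)
    (A : Matrix (Fin n) (Fin n) (LaurentSeries ℂ))
    (hAO : ∀ i j : Fin n, ∀ k : ℤ, k < r → (A i j).coeff k = 0)
    (hAr : IsNilpotent (Matrix.of fun i j => (A i j).coeff r : Matrix (Fin n) (Fin n) ℂ)) :
    ∃ g : GL (Fin n) (LaurentSeries ℂ),
      (∀ i j : Fin n, ∀ k : ℤ, k < r → ((gaugeGL g A) i j).coeff k = 0) ∧
      (Matrix.of fun i j => ((gaugeGL g A) i j).coeff r : Matrix (Fin n) (Fin n) ℂ) ^ n = 0 ∧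
      (Matrix.of fun i j => ((gaugeGL g A) i j).coeff r : Matrix (Fin n) (Fin n) ℂ) ^ (n - 1) ≠ 0 := by
  let s : ℤ := -r
  have hs : 2 ≤ s := by omega
  let A' : Matrix (Fin n) (Fin n) (LaurentSeries ℂ) := single s (1 : ℂ) • A
  have hA'c (i j : Fin n) (k : ℤ) : (A' i j).coeff k = (A i j).coeff (k + r) := by
    simp [A', s, coeff_single_mul]
  have hA' : ∀ i j, ∀ k < 0, (A' i j).coeff k = 0 := fun i j k hk => by
    rw [hA'c, hAO i j _ (by omega)]
  have hA'n : IsNilpotent (matCoeff 0 A') := by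
    convert hAr using 1
    ext i j
    simp [matCoeff, hA'c]
  have : CharZero (LaurentSeries ℂ) :=
    charZero_of_injective_algebraMap (algebraMap ℂ (LaurentSeries ℂ)).injective
  obtain ⟨e, he⟩ := exists_cyclic_vector (isLeibniz_powDerivation s)
    (powDerivation_single_one_ne_zero s) A'
  have := isLattice_orbitSpan hs hA' he
  obtain ⟨h, hM⟩ := exists_GL_mulVec_mem_iff (orbitSpan s A' e)
  let B : Matrix (Fin n) (Fin n) (LaurentSeries ℂ) := single s (1 : ℂ) • gaugeGL h⁻¹ A
  have hB : A' * h.1 + h.1.map (powDerivation s) = h.1 * B := by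
    have h1 : h.1.map (powDerivation s) = single s (1 : ℂ) • h.1.map dt := by
      ext1 i j
      rfl
    rw [h1, show B = single s (1 : ℂ) • gaugeGL h⁻¹ A from rfl, gaugeGL_inv]
    exact smul_mul_add_smul_eq (Units.mul_inv h) _ _ _
  have hB0 : ∀ i j, ∀ k < 0, (B i j).coeff k = 0 := by
    intro i j k hk
    have h1 := (hM (Pi.single j 1)).2 fun i k hk => by
      rw [Pi.single_apply]
      split_ifs
      · exact coeff_single_of_ne hk.ne
      · rfl
    have h2 := connection_mem_orbitSpan hs h1
    rw [connection_mulVec (isLeibniz_powDerivation s) hB, hM] at h2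
    have h3 : powDerivation s ((Pi.single j 1 : Fin n → LaurentSeries ℂ) i) = 0 := by
      rw [Pi.single_apply]
      split_ifs
      · exact (isLeibniz_powDerivation s).map_one
      · exact map_zero _
    simpa [connection_apply, h3] using h2 i k hk
  have hgc (i j : Fin n) (k : ℤ) : (gaugeGL h⁻¹ A i j).coeff k = (B i j).coeff (k - r) := by
    simp [B, s, coeff_single_mul]
  have hg : (Matrix.of fun i j => (gaugeGL h⁻¹ A i j).coeff r) = matCoeff 0 B := by
    ext i j
    simp [matCoeff, hgc]
  refine ⟨h⁻¹, fun i j k hk => ?_, ?_, ?_⟩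
  · rw [hgc, hB0 i j _ (by omega)]
  · rw [hg]
    exact pow_card_eq_zero_of_isNilpotent (isNilpotent_matCoeff_of_gauge hs hA' hA'n hB0 hB)
  · rw [hg]
    exact pow_pred_ne_zero_of_span_eq_top hn (span_matCoeff_pow_mulVec_eq_top hs hB0 hB hM)
end
end
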